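/- arXiv:0804.1825 — 2 statements merged into one kernel-verified Lean document; each statement's English description precedes it below -/
import Mathlib

section
/- The zero-divisor cup length of A_n^+ equals 2n − 3: every product of 2n − 2 elements of ker μ is zero in A_n^+ ⊗̂ A_n^+. -/
/-- Index set for the generators `a_{i,j}`, `i < j`, of `H^*(PΣ_n⁺; ℚ)`. -/
abbrev McIdx (n : ℕ) := {p : Fin n × Fin n // p.1 < p.2}

/-- The exterior algebra over `ℚ` on degree-one generators `a_{i,j}`, `i < j`. -/
abbrev McExt (n : ℕ) := ExteriorAlgebra ℚ (McIdx n →₀ ℚ)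

/-- The degree-one generator `a_{i,j}` (`i < j`) of the exterior algebra. -/
noncomputable def mcGen (n : ℕ) (p : McIdx n) : McExt n :=
  ExteriorAlgebra.ι ℚ (Finsupp.single p (1 : ℚ))

/-- The relations defining `H^*(PΣ_n⁺; ℚ)` as a quotient of the exterior algebra:
`a_{i,j} a_{i,k} - a_{i,j} a_{j,k} = 0` for `i < j < k`. -/
inductive McRel (n : ℕ) : McExt n → McExt n → Prop
  | tri {i j k : Fin n} (hij : i < j) (hjk : j < k) :
      McRel n (mcGen n ⟨(i, j), hij⟩ * mcGen n ⟨(i, k), hij.trans hjk⟩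
        - mcGen n ⟨(i, j), hij⟩ * mcGen n ⟨(j, k), hjk⟩) 0

/-- `A_n⁺ = E⁺/I⁺`, the rational cohomology ring of `PΣ_n⁺`. -/
abbrev McA (n : ℕ) := RingQuot (McRel n)

/-- The image `a_{i,j}` (`i < j`) in `A_n⁺` of the exterior generator. -/
noncomputable def mcA (n : ℕ) (p : McIdx n) : McA n :=
  RingQuot.mkAlgHom ℚ (McRel n) (mcGen n p)

/-! ### The graded tensor product `A_n⁺ ⊗̂ A_n⁺`.

Since all the generators `a_{i,j}` have odd degree `1`, the graded tensor product
`A_n⁺ ⊗̂ A_n⁺` (with the Koszul sign convention) is realized concretely as the quotient of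
the exterior algebra on two disjoint copies (`left` and `right`) of the generating set, by
the defining relations imposed on each copy.  The element `u ⊗ v` corresponds to
`(left u) * (right v)`, and the multiplication map `μ : A ⊗̂ A → A`, `u ⊗ v ↦ uv`, is the
unique `ℚ`-algebra map sending both copies of `a_{i,j}` to `a_{i,j}`. -/

/-- Exterior algebra on two copies of the generators. -/
abbrev McExt₂ (n : ℕ) := ExteriorAlgebra ℚ ((McIdx n ⊕ McIdx n) →₀ ℚ)

/-- Generator of the exterior algebra on two copies of the index set. -/
noncomputable def mcGen₂ (n : ℕ) (s : McIdx n ⊕ McIdx n) : McExt₂ n :=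
  ExteriorAlgebra.ι ℚ (Finsupp.single s (1 : ℚ))

/-- The defining relations of `A_n⁺`, imposed on each of the two copies of the generators. -/
inductive McRel₂ (n : ℕ) : McExt₂ n → McExt₂ n → Prop
  | triL {i j k : Fin n} (hij : i < j) (hjk : j < k) :
      McRel₂ n (mcGen₂ n (.inl ⟨(i, j), hij⟩) * mcGen₂ n (.inl ⟨(i, k), hij.trans hjk⟩)
        - mcGen₂ n (.inl ⟨(i, j), hij⟩) * mcGen₂ n (.inl ⟨(j, k), hjk⟩)) 0
  | triR {i j k : Fin n} (hij : i < j) (hjk : j < k) :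
      McRel₂ n (mcGen₂ n (.inr ⟨(i, j), hij⟩) * mcGen₂ n (.inr ⟨(i, k), hij.trans hjk⟩)
        - mcGen₂ n (.inr ⟨(i, j), hij⟩) * mcGen₂ n (.inr ⟨(j, k), hjk⟩)) 0

/-- The graded tensor product `A_n⁺ ⊗̂ A_n⁺`. -/
abbrev McTensor (n : ℕ) := RingQuot (McRel₂ n)

/-- The element `a ⊗ 1` of `A_n⁺ ⊗̂ A_n⁺`, for a generator `a = a_{i,j}`. -/
noncomputable def mcL (n : ℕ) (p : McIdx n) : McTensor n :=
  RingQuot.mkAlgHom ℚ (McRel₂ n) (mcGen₂ n (.inl p))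

/-- The element `1 ⊗ a` of `A_n⁺ ⊗̂ A_n⁺`, for a generator `a = a_{i,j}`. -/
noncomputable def mcR (n : ℕ) (p : McIdx n) : McTensor n :=
  RingQuot.mkAlgHom ℚ (McRel₂ n) (mcGen₂ n (.inr p))

/-- The zero-divisor `ā = a ⊗ 1 - 1 ⊗ a`, for a generator `a = a_{i,j}`. -/
noncomputable def mcBar (n : ℕ) (p : McIdx n) : McTensor n :=
  mcL n p - mcR n p

section Anticommuting

variable {T : Type*} [Ring T] [Algebra ℚ T]

/-- Submodules spanned by pairwise anticommuting elements commute. -/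
theorem Submodule.commute_of_anticommute {P Q : Submodule ℚ T}
    (h : ∀ x ∈ P, ∀ y ∈ Q, x * y = -(y * x)) : Commute P Q := by
  apply le_antisymm
  · refine Submodule.mul_le.2 fun x hx y hy => ?_
    rw [h x hx y hy]
    exact neg_mem (Submodule.mul_mem_mul hy hx)
  · refine Submodule.mul_le.2 fun y hy x hx => ?_
    rw [← neg_neg (y * x), ← h x hx y hy]
    exact neg_mem (Submodule.mul_mem_mul hx hy)

theorem Submodule.list_ofFn_prod_mem_pow (J : Submodule ℚ T) :
    ∀ (m : ℕ) (z : Fin m → T), (∀ k, z k ∈ J) → (List.ofFn z).prod ∈ J ^ m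
  | 0, z, _ => by simpa using Submodule.one_le.1 (le_refl (1 : Submodule ℚ T))
  | m + 1, z, hz => by
    rw [List.ofFn_succ, List.prod_cons, pow_succ']
    exact Submodule.mul_mem_mul (hz 0)
      (Submodule.list_ofFn_prod_mem_pow J m _ fun k => hz k.succ)

/-- If `D` can be moved to the left past every element, the powers of the ideal `D * ⊤` are
controlled by the powers of `D`. -/
theorem Submodule.mul_top_pow_le {D : Submodule ℚ T} (h : ⊤ * D ≤ D * ⊤) :
    ∀ m : ℕ, (D * ⊤) ^ m ≤ D ^ m * ⊤
  | 0 => by simp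
  | m + 1 => by
    calc (D * ⊤) ^ (m + 1) = (D * ⊤) ^ m * (D * ⊤) := pow_succ _ _
      _ ≤ D ^ m * ⊤ * (D * ⊤) := mul_le_mul_left (Submodule.mul_top_pow_le h m) _
      _ = D ^ m * (⊤ * D) * ⊤ := by simp only [mul_assoc]
      _ ≤ D ^ m * (D * ⊤) * ⊤ := by gcongr
      _ = D ^ (m + 1) * (⊤ * ⊤) := by simp only [pow_succ, mul_assoc]
      _ ≤ D ^ (m + 1) * ⊤ := by gcongr; exact le_top

/-- Elements satisfying the relations of `A_n⁺`, with the last of them equal to zero, span a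
subspace whose `(n - 1)`-st power vanishes. -/
theorem span_pow_eq_zero_of_last_eq_zero {n : ℕ} (hn : 2 ≤ n) (b : McIdx n → T)
    (hsq : ∀ p, b p * b p = 0) (hanti : ∀ p q, b p * b q = -(b q * b p))
    (hrel : ∀ {i j k : Fin n} (hij : i < j) (hjk : j < k),
      b ⟨(i, j), hij⟩ * b ⟨(i, k), hij.trans hjk⟩ = b ⟨(i, j), hij⟩ * b ⟨(j, k), hjk⟩)
    (hlast : ∀ p : McIdx n, p.1.1.val + 2 = n → b p = 0) :
    Submodule.span ℚ (Set.range b) ^ (n - 1) = 0 := by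
  set F : ℕ → Submodule ℚ T := fun i => Submodule.span ℚ (b '' {p | i ≤ p.1.1.val}) with hF
  have mem : ∀ (i : ℕ) (p : McIdx n), i ≤ p.1.1.val → b p ∈ F i := fun i p hp =>
    Submodule.subset_span ⟨p, hp, rfl⟩
  have sq_le : ∀ i, F i * F i ≤ F (i + 1) * F i := by
    intro i
    rw [hF, Submodule.span_mul_span, Submodule.span_le]
    rintro _ ⟨_, ⟨p, hp, rfl⟩, _, ⟨q, hq, rfl⟩, rfl⟩
    simp only [Set.mem_ofPred_eq] at hp hq
    change b p * b q ∈ F (i + 1) * F i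
    rcases Nat.eq_or_lt_of_le hp with hp' | hp'
    · rcases Nat.eq_or_lt_of_le hq with hq' | hq'
      · obtain ⟨⟨i₁, j⟩, hij⟩ := p
        obtain ⟨⟨i₂, k⟩, hik⟩ := q
        obtain rfl : i₁ = i₂ := Fin.ext (hp'.symm.trans hq')
        simp only at hij hik hp' hp
        rcases lt_trichotomy j k with hjk | rfl | hjk
        · rw [hrel hij hjk, hanti]
          refine neg_mem (Submodule.mul_mem_mul (mem _ _ ?_) (mem _ _ hp))
          change i + 1 ≤ j.val
          omega
        · rw [hsq]
          exact zero_mem _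
        · rw [hanti, hrel hik hjk, hanti, neg_neg]
          refine Submodule.mul_mem_mul (mem _ _ ?_) (mem _ _ hp)
          change i + 1 ≤ k.val
          omega
      · rw [hanti]
        exact neg_mem (Submodule.mul_mem_mul (mem _ _ hq') (mem _ _ hp))
    · exact Submodule.mul_mem_mul (mem _ _ hp') (mem _ _ hq)
  have pow_le : ∀ i k, F i ^ (k + 1) ≤ F (i + 1) ^ k * F i := by
    intro i k
    induction k with
    | zero => simp
    | succ k ih =>
      calc F i ^ (k + 1 + 1) = F i ^ (k + 1) * F i := pow_succ _ _
        _ ≤ F (i + 1) ^ k * F i * F i := mul_le_mul_left ih _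
        _ = F (i + 1) ^ k * (F i * F i) := mul_assoc _ _ _
        _ ≤ F (i + 1) ^ k * (F (i + 1) * F i) := mul_le_mul_right (sq_le i) _
        _ = F (i + 1) ^ (k + 1) * F i := by rw [pow_succ, mul_assoc]
  have pow_zero : ∀ k i, i + k + 2 = n → F i ^ (k + 1) = 0 := by
    intro k
    induction k with
    | zero =>
      intro i hi
      rw [zero_add, pow_one, hF, Submodule.zero_eq_bot, Submodule.span_eq_bot]
      rintro _ ⟨p, hp, rfl⟩
      have h₁ : p.1.1.val < p.1.2.val := p.2
      have h₂ := p.1.2.isLt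
      simp only [Set.mem_ofPred_eq] at hp
      exact hlast p (by omega)
    | succ k ih =>
      intro i hi
      have := pow_le i (k + 1)
      rw [ih (i + 1) (by omega), zero_mul] at this
      exact le_antisymm this bot_le
  have := pow_zero (n - 2) 0 (by omega)
  rw [show n - 2 + 1 = n - 1 by omega] at this
  simpa [hF, Set.image_univ] using this

end Anticommuting

/-- The index `(n - 1, n)` (in one-based numbering) of the last generator. -/
def mcLast {n : ℕ} (hn : 2 ≤ n) : McIdx n :=
  ⟨(⟨n - 2, by omega⟩, ⟨n - 1, by omega⟩), by rw [Fin.mk_lt_mk]; omega⟩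

/-- The coefficient of the last generator in the change of generators `mcShift`. -/
def mcCoeff {n : ℕ} (p : McIdx n) : ℚ := if p.1.2.val + 1 = n then 1 else 0

/-- The generators `a_{i,j}`, with `a_{n-1,n}` subtracted from those with `j = n`. -/
def mcShift {T : Type*} [Ring T] [Algebra ℚ T] {n : ℕ} (hn : 2 ≤ n) (x : McIdx n → T)
    (p : McIdx n) : T :=
  x p - mcCoeff p • x (mcLast hn)

theorem span_mcShift_pow_eq_zero {T : Type*} [Ring T] [Algebra ℚ T] {n : ℕ} (hn : 2 ≤ n)
    (x : McIdx n → T) (hsq : ∀ p, x p * x p = 0) (hanti : ∀ p q, x p * x q = -(x q * x p))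
    (hrel : ∀ {i j k : Fin n} (hij : i < j) (hjk : j < k),
      x ⟨(i, j), hij⟩ * x ⟨(i, k), hij.trans hjk⟩ = x ⟨(i, j), hij⟩ * x ⟨(j, k), hjk⟩) :
    Submodule.span ℚ (Set.range (mcShift hn x)) ^ (n - 1) = 0 := by
  have hanti' : ∀ p q, mcShift hn x p * mcShift hn x q = -(mcShift hn x q * mcShift hn x p) := by
    intro p q
    simp only [mcShift, sub_mul, mul_sub, smul_mul_assoc, mul_smul_comm, hsq, smul_zero]
    rw [hanti p q, hanti p (mcLast hn), hanti (mcLast hn) q]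
    simp only [smul_neg, sub_zero]
    abel
  refine span_pow_eq_zero_of_last_eq_zero hn _ (fun p => ?_) hanti' ?_ ?_
  · simp only [mcShift, sub_mul, mul_sub, smul_mul_assoc, mul_smul_comm, hsq, smul_zero]
    rw [hanti p (mcLast hn)]
    simp only [smul_neg, sub_zero]
    abel
  · intro i j k hij hjk
    have h₀ : mcCoeff (⟨(i, j), hij⟩ : McIdx n) = 0 := by
      have h₁ : j.val < k.val := hjk
      have h₂ := k.isLt
      exact if_neg (by simp only; omega)
    simp only [mcShift, h₀, zero_smul, sub_zero, mul_sub, hrel hij hjk]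
    rfl
  · rintro ⟨⟨i, j⟩, hij⟩ hp
    have h₁ : i.val < j.val := hij
    have h₂ := j.isLt
    simp only at hp
    have h₃ : (⟨(i, j), hij⟩ : McIdx n) = mcLast hn := by
      apply Subtype.ext
      apply Prod.ext <;> apply Fin.ext <;> simp only [mcLast] <;> omega
    have h₄ : mcCoeff (mcLast hn) = 1 := if_pos (by simp only [mcLast]; omega)
    rw [h₃, mcShift, h₄, one_smul, sub_self]

/-- The inclusion of the degree-one part of `A_n⁺ ⊗̂ A_n⁺`. -/
noncomputable def mcι (n : ℕ) : ((McIdx n ⊕ McIdx n) →₀ ℚ) →ₗ[ℚ] McTensor n :=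
  (RingQuot.mkAlgHom ℚ (McRel₂ n)).toLinearMap ∘ₗ ExteriorAlgebra.ι ℚ

theorem mcι_sq (n : ℕ) (v : (McIdx n ⊕ McIdx n) →₀ ℚ) : mcι n v * mcι n v = 0 := by
  simp only [mcι, LinearMap.comp_apply, AlgHom.toLinearMap_apply]
  rw [← map_mul, ExteriorAlgebra.ι_sq_zero, map_zero]

theorem mcι_anticomm (n : ℕ) (v w : (McIdx n ⊕ McIdx n) →₀ ℚ) :
    mcι n v * mcι n w = -(mcι n w * mcι n v) := by
  have h := mcι_sq n (v + w)
  rw [map_add, mul_add, add_mul, add_mul, mcι_sq, mcι_sq, zero_add, add_zero] at h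
  exact eq_neg_of_add_eq_zero_right h

theorem mcL_eq (n : ℕ) (p : McIdx n) : mcL n p = mcι n (Finsupp.single (.inl p) 1) := rfl

theorem mcR_eq (n : ℕ) (p : McIdx n) : mcR n p = mcι n (Finsupp.single (.inr p) 1) := rfl

theorem mcBar_eq (n : ℕ) (p : McIdx n) :
    mcBar n p = mcι n (Finsupp.single (.inl p) 1 - Finsupp.single (.inr p) 1) := by
  rw [map_sub]
  rfl

theorem mcL_rel {n : ℕ} {i j k : Fin n} (hij : i < j) (hjk : j < k) :
    mcL n ⟨(i, j), hij⟩ * mcL n ⟨(i, k), hij.trans hjk⟩ =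
      mcL n ⟨(i, j), hij⟩ * mcL n ⟨(j, k), hjk⟩ := by
  have h := RingQuot.mkAlgHom_rel ℚ (McRel₂.triL hij hjk)
  rw [map_sub, map_mul, map_mul, map_zero] at h
  exact sub_eq_zero.1 h

theorem mcR_rel {n : ℕ} {i j k : Fin n} (hij : i < j) (hjk : j < k) :
    mcR n ⟨(i, j), hij⟩ * mcR n ⟨(i, k), hij.trans hjk⟩ =
      mcR n ⟨(i, j), hij⟩ * mcR n ⟨(j, k), hjk⟩ := by
  have h := RingQuot.mkAlgHom_rel ℚ (McRel₂.triR hij hjk)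
  rw [map_sub, map_mul, map_mul, map_zero] at h
  exact sub_eq_zero.1 h

/-- The algebra `A_n⁺ ⊗̂ A_n⁺` is generated by its degree-one part. -/
theorem mcTensor_induction {n : ℕ} {C : McTensor n → Prop}
    (algebraMap : ∀ r, C (algebraMap ℚ (McTensor n) r)) (ι : ∀ v, C (mcι n v))
    (mul : ∀ a b, C a → C b → C (a * b)) (add : ∀ a b, C a → C b → C (a + b))
    (x : McTensor n) : C x := by
  obtain ⟨y, rfl⟩ := RingQuot.mkAlgHom_surjective ℚ (McRel₂ n) x
  induction y using ExteriorAlgebra.induction with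
  | algebraMap r => rw [AlgHom.commutes]; exact algebraMap r
  | ι v => exact ι v
  | mul a b ha hb => rw [map_mul]; exact mul _ _ ha hb
  | add a b ha hb => rw [map_add]; exact add _ _ ha hb

/-- The map `u ↦ u ⊗ 1`. -/
theorem exists_mcA_section (n : ℕ) :
    ∃ σ : McA n →ₐ[ℚ] McTensor n, ∀ p, σ (mcA n p) = mcL n p := by
  have key : ∀ p, ExteriorAlgebra.lift ℚ
      ⟨mcι n ∘ₗ Finsupp.lmapDomain ℚ ℚ (Sum.inl : McIdx n → McIdx n ⊕ McIdx n),
        fun v => mcι_sq n _⟩ (mcGen n p) = mcL n p := by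
    intro p
    rw [mcGen, ExteriorAlgebra.lift_ι_apply, LinearMap.comp_apply, Finsupp.lmapDomain_apply,
      Finsupp.mapDomain_single, mcL_eq]
  refine ⟨RingQuot.liftAlgHom ℚ ⟨ExteriorAlgebra.lift ℚ
      ⟨mcι n ∘ₗ Finsupp.lmapDomain ℚ ℚ (Sum.inl : McIdx n → McIdx n ⊕ McIdx n),
        fun v => mcι_sq n _⟩, ?_⟩, fun p => ?_⟩
  · rintro _ _ ⟨hij, hjk⟩
    rw [map_zero, map_sub, map_mul, map_mul, key, key, key, mcL_rel hij hjk, sub_self]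
  · rw [mcA, RingQuot.liftAlgHom_mkAlgHom_apply, key]

/-- The span of the zero-divisors `ā_{i,j}`. -/
noncomputable def mcBarSpan (n : ℕ) : Submodule ℚ (McTensor n) :=
  Submodule.span ℚ (Set.range (mcBar n))

theorem mcBarSpan_le_range (n : ℕ) : mcBarSpan n ≤ LinearMap.range (mcι n) := by
  rw [mcBarSpan, Submodule.span_le]
  rintro _ ⟨p, rfl⟩
  exact ⟨_, (mcBar_eq n p).symm⟩

theorem top_mul_mcBarSpan_le (n : ℕ) : ⊤ * mcBarSpan n ≤ mcBarSpan n * ⊤ := by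
  have key : ∀ t : McTensor n, ∀ y ∈ mcBarSpan n * ⊤, t * y ∈ mcBarSpan n * ⊤ := by
    intro t
    induction t using mcTensor_induction with
    | algebraMap r =>
      intro y hy
      rw [← Algebra.smul_def]
      exact Submodule.smul_mem _ r hy
    | ι v =>
      intro y hy
      induction hy using Submodule.mul_induction_on' with
      | mem_mul_mem d hd u _ =>
        obtain ⟨w, hw⟩ := mcBarSpan_le_range n hd
        rw [← hw, ← mul_assoc, mcι_anticomm, hw, neg_mul, mul_assoc]
        exact neg_mem (Submodule.mul_mem_mul hd trivial)
      | add a _ b _ ha hb => rw [mul_add]; exact add_mem ha hb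
    | mul a b ha hb => intro y hy; rw [mul_assoc]; exact ha _ (hb _ hy)
    | add a b ha hb => intro y hy; rw [add_mul]; exact add_mem (ha _ hy) (hb _ hy)
  refine Submodule.mul_le.2 fun t _ d hd => key t d ?_
  simpa using Submodule.mul_mem_mul hd (Submodule.mem_top (x := (1 : McTensor n)))

/-- The kernel of the multiplication map is contained in the ideal generated by the `ā_{i,j}`. -/
theorem ker_le_mcBarSpan_mul_top {n : ℕ} (μ : McTensor n →ₐ[ℚ] McA n)
    (hμL : ∀ p : McIdx n, μ (mcL n p) = mcA n p) (hμR : ∀ p : McIdx n, μ (mcR n p) = mcA n p)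
    {x : McTensor n} (hx : μ x = 0) : x ∈ mcBarSpan n * ⊤ := by
  obtain ⟨σ, hσ⟩ := exists_mcA_section n
  have hr : ∀ y ∈ mcBarSpan n * ⊤, ∀ t, y * t ∈ mcBarSpan n * ⊤ := by
    intro y hy t
    have := Submodule.mul_mem_mul hy (Submodule.mem_top (x := t))
    rw [mul_assoc] at this
    exact mul_le_mul_right (le_top : (⊤ * ⊤ : Submodule ℚ (McTensor n)) ≤ ⊤) (mcBarSpan n) this
  have hl : ∀ y ∈ mcBarSpan n * ⊤, ∀ t, t * y ∈ mcBarSpan n * ⊤ := by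
    intro y hy t
    have := Submodule.mul_mem_mul (Submodule.mem_top (x := t)) hy
    rw [← mul_assoc] at this
    have h := mul_le_mul_left (top_mul_mcBarSpan_le n) ⊤ this
    rw [mul_assoc] at h
    exact mul_le_mul_right (le_top : (⊤ * ⊤ : Submodule ℚ (McTensor n)) ≤ ⊤) (mcBarSpan n) h
  have key : ∀ y, y - σ (μ y) ∈ mcBarSpan n * ⊤ := by
    intro y
    induction y using mcTensor_induction with
    | algebraMap r => rw [AlgHom.commutes, AlgHom.commutes, sub_self]; exact zero_mem _
    | ι v =>
      induction v using Finsupp.induction_linear with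
      | zero => simp
      | add v w hv hw =>
        simp only [map_add]
        rw [add_sub_add_comm]
        exact add_mem hv hw
      | single s r =>
        rw [← Finsupp.smul_single_one, map_smul, map_smul, map_smul, ← smul_sub]
        refine Submodule.smul_mem _ r ?_
        rcases s with p | p
        · rw [← mcL_eq, hμL, hσ, sub_self]
          exact zero_mem _
        · rw [← mcR_eq, hμR, hσ, ← neg_sub]
          have := Submodule.mul_mem_mul (Submodule.subset_span ⟨p, rfl⟩ : mcBar n p ∈ mcBarSpan n)
            (Submodule.mem_top (x := (1 : McTensor n)))
          rw [mul_one] at this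
          exact neg_mem this
    | mul a b ha hb =>
      have : a * b - σ (μ (a * b)) = (a - σ (μ a)) * b + σ (μ a) * (b - σ (μ b)) := by
        rw [map_mul, map_mul, sub_mul, mul_sub]
        abel
      rw [this]
      exact add_mem (hr _ ha _) (hl _ hb _)
    | add a b ha hb =>
      simp only [map_add]
      rw [add_sub_add_comm]
      exact add_mem ha hb
  simpa [hx] using key x

theorem mcBarSpan_pow_eq_zero {n : ℕ} (hn : 2 ≤ n) : mcBarSpan n ^ (2 * n - 2) = 0 := by
  set P := Submodule.span ℚ (Set.range (mcShift hn (mcL n))) with hP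
  set Q := Submodule.span ℚ (Set.range (mcShift hn (mcR n))) with hQ
  set C := Submodule.span ℚ {mcBar n (mcLast hn)} with hC
  have comm : ∀ {U W : Submodule ℚ (McTensor n)}, U ≤ LinearMap.range (mcι n) →
      W ≤ LinearMap.range (mcι n) → Commute U W := fun hU hW =>
    Submodule.commute_of_anticommute fun x hx y hy => by
      obtain ⟨v, rfl⟩ := hU hx
      obtain ⟨w, rfl⟩ := hW hy
      exact mcι_anticomm n v w
  have hPr : P ≤ LinearMap.range (mcι n) := by
    rw [hP, Submodule.span_le]
    rintro _ ⟨p, rfl⟩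
    exact sub_mem ⟨_, rfl⟩ (Submodule.smul_mem _ _ ⟨_, rfl⟩)
  have hQr : Q ≤ LinearMap.range (mcι n) := by
    rw [hQ, Submodule.span_le]
    rintro _ ⟨p, rfl⟩
    exact sub_mem ⟨_, rfl⟩ (Submodule.smul_mem _ _ ⟨_, rfl⟩)
  have hCr : C ≤ LinearMap.range (mcι n) := by
    rw [hC, Submodule.span_le, Set.singleton_subset_iff]
    exact ⟨_, (mcBar_eq n _).symm⟩
  have hP0 : P ^ (n - 1) = 0 := span_mcShift_pow_eq_zero hn _ (fun p => mcι_sq n _)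
    (fun p q => mcι_anticomm n _ _) mcL_rel
  have hQ0 : Q ^ (n - 1) = 0 := span_mcShift_pow_eq_zero hn _ (fun p => mcι_sq n _)
    (fun p q => mcι_anticomm n _ _) mcR_rel
  have hC0 : C ^ 2 = 0 := by
    rw [hC, sq, Submodule.span_mul_span, Set.singleton_mul_singleton, mcBar_eq, mcι_sq,
      Submodule.span_zero_singleton]
    rfl
  have hPQ : (P + Q) ^ (2 * n - 3) = 0 :=
    (comm hPr hQr).add_pow_eq_zero_of_add_le_succ_of_pow_eq_zero hP0 hQ0 (by omega)
  have hPQC : (P + Q + C) ^ (2 * n - 2) = 0 :=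
    (comm (sup_le hPr hQr) hCr).add_pow_eq_zero_of_add_le_succ_of_pow_eq_zero hPQ hC0 (by omega)
  have hle : mcBarSpan n ≤ P + Q + C := by
    rw [mcBarSpan, Submodule.span_le]
    rintro _ ⟨p, rfl⟩
    have h : mcBar n p = mcShift hn (mcL n) p - mcShift hn (mcR n) p
        + mcCoeff p • mcBar n (mcLast hn) := by
      simp only [mcBar, mcShift, smul_sub]
      abel
    rw [h]
    refine Submodule.add_mem_sup (sub_mem ?_ ?_) (Submodule.smul_mem _ _
      (Submodule.mem_span_singleton_self _))
    · exact Submodule.mem_sup_left (Submodule.subset_span ⟨p, rfl⟩)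
    · exact Submodule.mem_sup_right (Submodule.subset_span ⟨p, rfl⟩)
  exact le_antisymm (hPQC ▸ pow_le_pow_left' hle _) bot_le

/-- The second family of basis vectors, with the one of index `0` replaced by zero. -/
def mcVec {n : ℕ} (i : Fin n) : Fin n ⊕ Fin n → ℚ :=
  if i.val = 0 then 0 else Pi.single (.inr i) 1

/-- An algebra map from `A_n⁺ ⊗̂ A_n⁺` to an exterior algebra on `2n` generators, sending
`ā_{i,j}` to the sum of the `j`-th vector of the first family and the `i`-th vector of the
second. -/
theorem exists_mcTensor_hom (n : ℕ) :
    ∃ θ : McTensor n →ₐ[ℚ] ExteriorAlgebra ℚ (Fin n ⊕ Fin n → ℚ),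
      ∀ p, θ (mcBar n p) =
        ExteriorAlgebra.ι ℚ ((Pi.single (.inl p.1.2) 1 : Fin n ⊕ Fin n → ℚ) + mcVec p.1.1) := by
  set f : McIdx n ⊕ McIdx n → (Fin n ⊕ Fin n → ℚ) := Sum.elim
    (fun p => Pi.single (.inl p.1.2) 1 + mcVec p.1.2) (fun p => mcVec p.1.2 - mcVec p.1.1) with hf
  set g : McExt₂ n →ₐ[ℚ] ExteriorAlgebra ℚ (Fin n ⊕ Fin n → ℚ) :=
    ExteriorAlgebra.map (Finsupp.linearCombination ℚ f) with hg
  have key : ∀ s, g (mcGen₂ n s) = ExteriorAlgebra.ι ℚ (f s) := by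
    intro s
    rw [hg, mcGen₂, ExteriorAlgebra.map_apply_ι, Finsupp.linearCombination_single, one_smul]
  refine ⟨RingQuot.liftAlgHom ℚ ⟨g, ?_⟩, fun p => ?_⟩
  · rintro _ _ (⟨hij, hjk⟩ | ⟨hij, hjk⟩) <;>
      rw [map_zero, map_sub, map_mul, map_mul, key, key, key, ← mul_sub, ← map_sub]
    · simp [hf]
    · simp only [hf, Sum.elim_inr]
      rw [sub_sub_sub_cancel_left, ExteriorAlgebra.ι_sq_zero]
  · rw [mcBar, mcL, mcR, map_sub, RingQuot.liftAlgHom_mkAlgHom_apply,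
      RingQuot.liftAlgHom_mkAlgHom_apply, key, key, ← map_sub]
    congr 1
    simp only [hf, Sum.elim_inl, Sum.elim_inr]
    abel

/-- A product of distinct standard basis vectors in an exterior algebra is nonzero. -/
theorem ExteriorAlgebra.ofFn_ι_single_prod_ne_zero {κ : Type*} [DecidableEq κ] {m : ℕ}
    (f : Fin m → κ) (hf : Function.Injective f) :
    (List.ofFn fun k => ExteriorAlgebra.ι ℚ (Pi.single (f k) 1 : κ → ℚ)).prod ≠ 0 := by
  rw [← ExteriorAlgebra.ιMulti_apply]
  intro h
  have h₁ := congrArg (ExteriorAlgebra.liftAlternating (R := ℚ) (Function.update 0 m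
    ((Pi.basisFun ℚ (Fin m)).det.compLinearMap (LinearMap.funLeft ℚ ℚ f)))) h
  rw [ExteriorAlgebra.liftAlternating_apply_ιMulti, map_zero, Function.update_self,
    AlternatingMap.compLinearMap_apply] at h₁
  have h₂ : (fun k => LinearMap.funLeft ℚ ℚ f (Pi.single (f k) 1 : κ → ℚ)) =
      Pi.basisFun ℚ (Fin m) := by
    funext k l
    simp [LinearMap.funLeft_apply, Pi.single_apply, hf.eq_iff]
  have h₃ := (Pi.basisFun ℚ (Fin m)).det_self
  rw [← h₂] at h₃
  exact one_ne_zero (h₃.symm.trans h₁)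

/-- There is a nonzero product of `2n - 3` linear combinations of the `ā_{i,j}`. -/
theorem exists_mcBarSpan_prod_ne_zero {n : ℕ} (hn : 2 ≤ n) :
    ∃ z : Fin (2 * n - 3) → McTensor n,
      (∀ k, z k ∈ mcBarSpan n) ∧ (List.ofFn z).prod ≠ 0 := by
  obtain ⟨θ, hθ⟩ := exists_mcTensor_hom n
  have mem : ∀ p, mcBar n p ∈ mcBarSpan n := fun p => Submodule.subset_span ⟨p, rfl⟩
  set f : Fin (2 * n - 3) → Fin n ⊕ Fin n := fun k =>
    if h : k.val < n - 1 then .inl ⟨k.val + 1, by omega⟩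
    else .inr ⟨k.val - (n - 1) + 1, by omega⟩ with hf
  have hinj : Function.Injective f := by
    intro k l hkl
    apply Fin.ext
    simp only [hf] at hkl
    split_ifs at hkl <;> simp at hkl <;> omega
  have hz : ∀ k, ∃ z ∈ mcBarSpan n,
      θ z = ExteriorAlgebra.ι ℚ (Pi.single (f k) 1 : Fin n ⊕ Fin n → ℚ) := by
    intro k
    by_cases h : k.val < n - 1
    · refine ⟨_, mem ⟨(⟨0, by omega⟩, ⟨k.val + 1, by omega⟩), by simp [Fin.lt_def]⟩, ?_⟩
      rw [hθ]
      simp [hf, h, mcVec]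
    · refine ⟨_, sub_mem (mem ⟨(⟨k.val - (n - 1) + 1, by omega⟩, ⟨n - 1, by omega⟩),
        by rw [Fin.mk_lt_mk]; omega⟩) (mem ⟨(⟨0, by omega⟩, ⟨n - 1, by omega⟩),
        by rw [Fin.mk_lt_mk]; omega⟩), ?_⟩
      rw [map_sub, hθ, hθ, ← map_sub]
      simp [hf, h, mcVec]
  choose z hzm hzθ using hz
  refine ⟨z, hzm, fun h => ExteriorAlgebra.ofFn_ι_single_prod_ne_zero f hinj ?_⟩
  have h₁ := congrArg θ h
  rw [map_zero, map_list_prod, List.map_ofFn] at h₁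
  rw [← h₁]
  congr 2
  funext k
  exact (hzθ k).symm

/-- The zero-divisor cup length of `A_n⁺` equals `2n - 3`: where
`μ : A_n⁺ ⊗̂ A_n⁺ → A_n⁺` denotes the multiplication map (the unique algebra map sending
both copies of each generator `a_{i,j}` to `a_{i,j}`), there is a nonzero product of
`2n - 3` elements of `ker μ`, while every product of `2n - 2` elements of `ker μ` is zero
in `A_n⁺ ⊗̂ A_n⁺`. -/
theorem mcA_zcl (n : ℕ) (hn : 2 ≤ n)
    (μ : McTensor n →ₐ[ℚ] McA n)
    (hμL : ∀ p : McIdx n, μ (mcL n p) = mcA n p)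
    (hμR : ∀ p : McIdx n, μ (mcR n p) = mcA n p) :
    (∃ z : Fin (2 * n - 3) → McTensor n,
      (∀ k, μ (z k) = 0) ∧ (List.ofFn z).prod ≠ 0) ∧
    (∀ z : Fin (2 * n - 2) → McTensor n,
      (∀ k, μ (z k) = 0) → (List.ofFn z).prod = 0) := by
  constructor
  · obtain ⟨z, hz, hne⟩ := exists_mcBarSpan_prod_ne_zero hn
    refine ⟨z, fun k => ?_, hne⟩
    have hle : mcBarSpan n ≤ LinearMap.ker μ.toLinearMap := by
      rw [mcBarSpan, Submodule.span_le]
      rintro _ ⟨p, rfl⟩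
      simp [mcBar, hμL, hμR]
    exact hle (hz k)
  · intro z hz
    have h := Submodule.list_ofFn_prod_mem_pow _ _ z fun k =>
      ker_le_mcBarSpan_mul_top μ hμL hμR (hz k)
    have h' := Submodule.mul_top_pow_le (top_mul_mcBarSpan_le n) _ h
    rw [mcBarSpan_pow_eq_zero hn, zero_mul] at h'
    exact h'
end

section
/- The cup length of A_n^+ equals n − 1: the product a_{1,2} a_{2,3} ⋯ a_{n−1,n} of n − 1 degree-one generators is nonzero in A_n^+, while any product of n of the degree-one generators a_{i,j} is zero in A_n^+. -/
theorem mcA_mul_self {n : ℕ} (p : McIdx n) : mcA n p * mcA n p = 0 := by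
  rw [mcA, ← map_mul, mcGen, ExteriorAlgebra.ι_sq_zero, map_zero]

theorem mcA_mul_swap {n : ℕ} (p q : McIdx n) : mcA n p * mcA n q = -(mcA n q * mcA n p) := by
  rw [eq_neg_iff_add_eq_zero]
  simp only [mcA, ← map_mul, ← map_add, mcGen]
  rw [ExteriorAlgebra.ι_add_mul_swap, map_zero]

theorem mcA_mul_tri {n : ℕ} {i j k : Fin n} (hij : i < j) (hjk : j < k) :
    mcA n ⟨(i, j), hij⟩ * mcA n ⟨(i, k), hij.trans hjk⟩
      = mcA n ⟨(i, j), hij⟩ * mcA n ⟨(j, k), hjk⟩ := by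
  have h := RingQuot.mkAlgHom_rel ℚ (McRel.tri hij hjk)
  rw [map_sub, map_mul, map_mul, map_zero, sub_eq_zero] at h
  exact h

/-- Permuting a product of degree-one generators changes it at most by a sign. -/
theorem mcA_prod_perm {n : ℕ} {l l' : List (McIdx n)} (h : l.Perm l') :
    (l.map (mcA n)).prod = (l'.map (mcA n)).prod ∨
      (l.map (mcA n)).prod = -(l'.map (mcA n)).prod := by
  induction h with
  | nil => exact Or.inl rfl
  | cons p _ ih =>
    simp only [List.map_cons, List.prod_cons]
    rcases ih with ih | ih <;> simp [ih]
  | swap p q l =>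
    right
    simp only [List.map_cons, List.prod_cons, ← mul_assoc]
    rw [mcA_mul_swap q p, neg_mul]
  | trans _ _ ih₁ ih₂ =>
    rcases ih₁ with ih₁ | ih₁ <;> rcases ih₂ with ih₂ | ih₂ <;> simp [ih₁, ih₂]

theorem mcA_prod_eq_zero_of_perm {n : ℕ} {l l' : List (McIdx n)} (h : l.Perm l')
    (h0 : (l'.map (mcA n)).prod = 0) : (l.map (mcA n)).prod = 0 := by
  rcases mcA_prod_perm h with h | h <;> simp [h, h0]

theorem List.exists_perm_cons_cons_of_not_nodup_map {α β : Type*} (f : α → β) (l : List α)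
    (h : ¬ (l.map f).Nodup) : ∃ a b t, l.Perm (a :: b :: t) ∧ f a = f b := by
  classical
  induction l with
  | nil => simp at h
  | cons x l ih =>
    by_cases hx : f x ∈ l.map f
    · obtain ⟨y, hy, hxy⟩ := List.mem_map.1 hx
      exact ⟨x, y, l.erase y, (List.perm_cons_erase hy).cons x, hxy.symm⟩
    · obtain ⟨a, b, t, hp, hab⟩ := ih fun hl => h (List.nodup_cons.2 ⟨hx, hl⟩)
      exact ⟨a, b, x :: t,
        (hp.cons x).trans ((List.Perm.swap a x _).trans ((List.Perm.swap b x t).cons a)), hab⟩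

theorem exists_perm_cons_cons_of_le_length {n : ℕ} (hn : 1 ≤ n) (l : List (McIdx n))
    (hl : n ≤ l.length) : ∃ p q t, l.Perm (p :: q :: t) ∧ p.1.1 = q.1.1 := by
  apply List.exists_perm_cons_cons_of_not_nodup_map (fun p : McIdx n => p.1.1) l
  intro h
  have hsub : (l.map fun p : McIdx n => p.1.1).toFinset ⊆
      Finset.univ.erase (⟨n - 1, by omega⟩ : Fin n) := by
    intro i hi
    obtain ⟨p, -, rfl⟩ := List.mem_map.1 (List.mem_toFinset.1 hi)
    have h₁ : p.1.1.1 < p.1.2.1 := p.2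
    have h₂ := p.1.2.2
    simp only [Finset.mem_erase, Finset.mem_univ, and_true, ne_eq, Fin.ext_iff]
    omega
  have hcard := Finset.card_le_card hsub
  rw [List.toFinset_card_of_nodup h, List.length_map, Finset.card_erase_of_mem (Finset.mem_univ _),
    Finset.card_univ, Fintype.card_fin] at hcard
  omega

/-- The relation `a_{i,j} a_{i,k} = a_{i,j} a_{j,k}` replaces a repeated smaller index by a larger
one, so the sum of the (reversed) smaller indices decreases until two factors coincide. -/
theorem mcA_prod_eq_zero {n : ℕ} (hn : 1 ≤ n) {l : List (McIdx n)} (hl : n ≤ l.length) :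
    (l.map (mcA n)).prod = 0 := by
  induction hm : (l.map fun p : McIdx n => n - p.1.1.1).sum using Nat.strong_induction_on
    generalizing l with
  | _ m ih =>
  have ordered : ∀ {i j k : Fin n} (hij : i < j) (hjk : j < k) (t : List (McIdx n)),
      l.Perm (⟨(i, j), hij⟩ :: ⟨(i, k), hij.trans hjk⟩ :: t) → (l.map (mcA n)).prod = 0 := by
    intro i j k hij hjk t hp
    apply mcA_prod_eq_zero_of_perm hp
    have hsum := (hp.map fun p : McIdx n => n - p.1.1.1).sum_eq
    have hlen := hp.length_eq
    have key := ih _ (l := ⟨(i, j), hij⟩ :: ⟨(j, k), hjk⟩ :: t) ?_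
      (hl.trans_eq hlen) rfl
    · simp only [List.map_cons, List.prod_cons, ← mul_assoc] at key ⊢
      rw [mcA_mul_tri hij hjk, key]
    · simp only [List.map_cons, List.sum_cons] at hsum ⊢
      have := i.2
      have : i.1 < j.1 := hij
      omega
  obtain ⟨⟨⟨i, j⟩, hij⟩, ⟨⟨i', k⟩, hik⟩, t, hp, hpq⟩ := exists_perm_cons_cons_of_le_length hn l hl
  obtain rfl : i = i' := hpq
  rcases lt_trichotomy j k with hjk | rfl | hkj
  · exact ordered hij hjk t hp
  · apply mcA_prod_eq_zero_of_perm hp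
    simp only [List.map_cons, List.prod_cons, ← mul_assoc]
    rw [mcA_mul_self, zero_mul]
  · exact ordered hik hkj t (hp.trans (List.Perm.swap _ _ _))

/-- The vector `∑_{q < i} e_q`. -/
def belowIndicator (n : ℕ) (i : Fin n) : Fin (n - 1) → ℚ := fun q => if q.1 < i.1 then 1 else 0

theorem belowIndicator_succ_sub {n : ℕ} (q : Fin (n - 1)) (h : q.1 < n) (h' : q.1 + 1 < n) :
    belowIndicator n ⟨q.1 + 1, h'⟩ - belowIndicator n ⟨q.1, h⟩ = Pi.single q 1 := by
  ext r
  rcases lt_trichotomy r q with hr | rfl | hr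
  · have : r.1 < q.1 := hr
    simp [belowIndicator, hr.ne, this, this.trans (Nat.lt_succ_self _)]
  · simp [belowIndicator]
  · have : q.1 < r.1 := hr
    simp [belowIndicator, hr.ne', this.not_gt, show ¬ r.1 < q.1 + 1 by omega]

/-- The algebra map on `E⁺` sending `a_{i,j}` to `∑_{i ≤ q < j} e_q`. -/
noncomputable def mcExtToExterior (n : ℕ) :
    McExt n →ₐ[ℚ] ExteriorAlgebra ℚ (Fin (n - 1) → ℚ) :=
  ExteriorAlgebra.map (Finsupp.linearCombination ℚ fun p : McIdx n =>
    belowIndicator n p.1.2 - belowIndicator n p.1.1)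

theorem mcExtToExterior_mcGen {n : ℕ} (p : McIdx n) :
    mcExtToExterior n (mcGen n p) =
      ExteriorAlgebra.ι ℚ (belowIndicator n p.1.2 - belowIndicator n p.1.1) := by
  simp [mcExtToExterior, mcGen]

/-- The algebra map on `A_n⁺` sending `a_{i,j}` to `∑_{i ≤ q < j} e_q`. -/
noncomputable def mcToExterior (n : ℕ) : McA n →ₐ[ℚ] ExteriorAlgebra ℚ (Fin (n - 1) → ℚ) :=
  RingQuot.liftAlgHom ℚ ⟨mcExtToExterior n, by
    rintro _ _ ⟨hij, hjk⟩
    rw [← mul_sub, map_mul, map_sub, map_zero]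
    simp only [mcExtToExterior_mcGen]
    rw [← map_sub, sub_sub_sub_cancel_left, ExteriorAlgebra.ι_sq_zero]⟩

theorem mcToExterior_mcA {n : ℕ} (p : McIdx n) :
    mcToExterior n (mcA n p) =
      ExteriorAlgebra.ι ℚ (belowIndicator n p.1.2 - belowIndicator n p.1.1) := by
  rw [mcToExterior, mcA, RingQuot.liftAlgHom_mkAlgHom_apply, mcExtToExterior_mcGen]

theorem ιMulti_single_one_ne_zero (m : ℕ) :
    ExteriorAlgebra.ιMulti ℚ m (fun q : Fin m => (Pi.single q 1 : Fin m → ℚ)) ≠ 0 := by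
  intro h
  have h' := congrArg (ExteriorAlgebra.liftAlternating (R := ℚ)
    (Pi.single m (Matrix.detRowAlternating (n := Fin m) (R := ℚ)))) h
  rw [ExteriorAlgebra.liftAlternating_apply_ιMulti, Pi.single_eq_same, map_zero] at h'
  have h1 : (fun q : Fin m => (Pi.single q 1 : Fin m → ℚ)) = (1 : Matrix (Fin m) (Fin m) ℚ) := by
    ext q r
    rw [Matrix.one_apply, Pi.single_apply]
    simp only [eq_comm]
  rw [h1] at h'
  exact one_ne_zero (Matrix.det_one.symm.trans h')

/-- The cup length of `A_n⁺` equals `n - 1`: the product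
`a_{1,2} a_{2,3} ⋯ a_{n-1,n}` of `n - 1` degree-one generators is nonzero in `A_n⁺`, while
any product of `n` of the degree-one generators `a_{i,j}` is zero in `A_n⁺`.
(Indices of `Fin n` are 0-based, so `a_{q,q+1}` for `q = 0, …, n-2` corresponds to the
1-based `a_{1,2}, …, a_{n-1,n}`.) -/
theorem mcA_cup_length (n : ℕ) (hn : 2 ≤ n) :
    (((List.finRange (n - 1)).map fun q : Fin (n - 1) =>
        mcA n ⟨(⟨q.1, by have := q.isLt; omega⟩, ⟨q.1 + 1, by have := q.isLt; omega⟩),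
          by simp only [Fin.mk_lt_mk]; omega⟩).prod ≠ 0) ∧
    (∀ g : Fin n → McIdx n, (List.ofFn fun k : Fin n => mcA n (g k)).prod = 0) := by
  refine ⟨?_, fun g => ?_⟩
  · intro h
    apply ιMulti_single_one_ne_zero (n - 1)
    have h' := congrArg (mcToExterior n) h
    rw [map_zero, map_list_prod, List.map_map] at h'
    rw [ExteriorAlgebra.ιMulti_apply, List.ofFn_eq_map, ← h']
    congr 1
    refine List.map_congr_left fun q _ => ?_
    simp only [Function.comp_apply, mcToExterior_mcA, belowIndicator_succ_sub]
  · rw [List.ofFn_eq_map, ← Function.comp_def (mcA n) g, ← List.map_map]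
    exact mcA_prod_eq_zero (by omega) (by simp)
end
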